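/- Deterministic coefficient-error bound underlying Theorem 2 (Step 6 of the proof): let k ≥ 1, n ≥ 1, κ > 0, ε ≥ 0, C₃ ≥ 0, δ_∞ ≥ 0, λ ≥ 0, δ ≥ 0, let L : ℝ^k → ℝ be differentiable (the loss with the true design), let L̂ : ℝ^k → ℝ be any function (the loss with the estimated design), and let β ∈ ℝ^k. Assume: (restricted strong convexity of L at β) for all Δ ∈ ℝ^k, (1/n)(L(β + Δ) − L(β) − ⟨∇L(β), Δ⟩) ≥ (κ/2)‖Δ‖₂²; (score bound) ‖(1/n)∇L(β)‖₂ ≤ ε; (measurement-error bias bound) |(L̂(β̂) − L(β̂)) − (L̂(β) − L(β))| ≤ C₃·n·δ_∞·‖β̂ − β‖₂; and β̂ is a global minimizer of b ↦ L̂(b) + λ√k‖b‖₂ + (δ/2)‖b‖₂². Then ‖β̂ − β‖₂ ≤ (2/κ)·(ε + C₃·δ_∞ + λ√k/n + δ·‖β‖₂/n). -/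

import Mathlib

open scoped RealInnerProductSpace

/-- Deterministic coefficient-error bound underlying Theorem 2 (Step 6 of the proof). -/
theorem theorem2_coefficient_bound {k n : ℕ} (hk : 1 ≤ k) (hn : 1 ≤ n)
    (κ ε C₃ δinf lam δ : ℝ)
    (hκ : 0 < κ) (hε : 0 ≤ ε) (hC₃ : 0 ≤ C₃) (hδinf : 0 ≤ δinf)
    (hlam : 0 ≤ lam) (hδ : 0 ≤ δ)
    (L : EuclideanSpace ℝ (Fin k) → ℝ) (hL : Differentiable ℝ L)
    (Lhat : EuclideanSpace ℝ (Fin k) → ℝ)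
    (β βhat : EuclideanSpace ℝ (Fin k))
    (hRSC : ∀ Δ : EuclideanSpace ℝ (Fin k),
      κ / 2 * ‖Δ‖ ^ 2 ≤ (1 / (n : ℝ)) * (L (β + Δ) - L β - ⟪gradient L β, Δ⟫))
    (hscore : ‖(1 / (n : ℝ)) • gradient L β‖ ≤ ε)
    (hbias : |(Lhat βhat - L βhat) - (Lhat β - L β)| ≤ C₃ * n * δinf * ‖βhat - β‖)
    (hmin : ∀ b : EuclideanSpace ℝ (Fin k),
      Lhat βhat + lam * Real.sqrt k * ‖βhat‖ + δ / 2 * ‖βhat‖ ^ 2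
        ≤ Lhat b + lam * Real.sqrt k * ‖b‖ + δ / 2 * ‖b‖ ^ 2) :
    ‖βhat - β‖ ≤ 2 / κ * (ε + C₃ * δinf + lam * Real.sqrt k / n + δ * ‖β‖ / n) := by
  have hn0 : (0 : ℝ) < n := by exact_mod_cast hn
  have h1 := hRSC (βhat - β)
  rw [add_sub_cancel] at h1
  have h2 : -⟪(1 / (n : ℝ)) • gradient L β, βhat - β⟫ ≤ ε * ‖βhat - β‖ :=
    (neg_le_abs _).trans ((abs_real_inner_le_norm _ _).trans
      (mul_le_mul_of_nonneg_right hscore (norm_nonneg _)))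
  rw [real_inner_smul_left] at h2
  have h3 := hmin β
  have h4 := (abs_le.mp hbias).1
  have h4' := (abs_le.mp hbias).2
  have h5 : ‖β‖ - ‖βhat‖ ≤ ‖βhat - β‖ := by
    rw [norm_sub_rev]; exact norm_sub_norm_le _ _
  have hd := norm_nonneg (βhat - β)
  have ha := norm_nonneg β
  have hs : 0 ≤ lam * Real.sqrt k := mul_nonneg hlam (Real.sqrt_nonneg _)
  generalize ⟪gradient L β, βhat - β⟫ = g at *
  generalize ‖βhat - β‖ = d at *
  generalize ‖β‖ = a at *
  generalize ‖βhat‖ = b at *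
  generalize lam * Real.sqrt k = s at *
  have h6 : a ^ 2 - b ^ 2 ≤ 2 * (a * d) := by
    nlinarith [mul_le_mul_of_nonneg_left h5 ha, sq_nonneg (a - b)]
  have h7 := mul_le_mul_of_nonneg_left h6 hδ
  have h8 := mul_le_mul_of_nonneg_left h5 hs
  have h9 : L βhat - L β ≤ (s + δ * a + C₃ * n * δinf) * d := by linarith
  have h10 : (1 / (n : ℝ)) * (L βhat - L β) ≤
      (C₃ * δinf + s / n + δ * a / n) * d := by
    refine (mul_le_mul_of_nonneg_left h9 (by positivity)).trans (le_of_eq ?_)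
    field_simp
    ring
  have h11 : κ / 2 * d ^ 2 ≤ (ε + C₃ * δinf + s / n + δ * a / n) * d := by
    linarith
  have hM : 0 ≤ ε + C₃ * δinf + s / n + δ * a / n := by positivity
  generalize ε + C₃ * δinf + s / n + δ * a / n = M at *
  rcases hd.eq_or_lt with h0 | h0
  · rw [← h0]; positivity
  · have h12 : κ / 2 * d ≤ M := by
      refine le_of_mul_le_mul_right ?_ h0
      linarith
    rw [div_mul_eq_mul_div, le_div_iff₀ hκ]
    linarith
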